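/- Let Ω⁺ ⊂ ℝ³ be a bounded open set with Lipschitz boundary satisfying an interior ball condition, let φ be the potential of the minimizer of the unconstrained problem, and let Ω₀ := ℝ³ \ closure({φ > 0}) be the uncharged region. Then dist(Ω₀, ∂Ω⁺) > 0. -/

import Mathlib

open MeasureTheory Real
open scoped RealInnerProductSpace

noncomputable section

abbrev E3 := EuclideanSpace ℝ (Fin 3)

/-- The Coulomb kernel in ℝ³. -/
def coul (x y : E3) : ℝ := 1 / (4 * π * ‖x - y‖)

/-- The Coulomb energy `E(Ω⁻)`. -/
def energy (Ωp Ωm : Set E3) : ℝ :=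
  (∫ x in Ωp, ∫ y in Ωp, coul x y) + (∫ x in Ωm, ∫ y in Ωm, coul x y)
    - 2 * ∫ x in Ωp, ∫ y in Ωm, coul x y

/-- Admissible configurations for the unconstrained problem. -/
def Adm (Ωp Ωm : Set E3) : Prop :=
  MeasurableSet Ωm ∧ volume (Ωp ∩ Ωm) = 0 ∧ volume Ωm < ⊤

/-- The potential `φ` generated by the charges `χ_{Ω⁺} − χ_{Ω⁻}`. -/
def potential (Ωp Ωm : Set E3) (x : E3) : ℝ :=
  ∫ y, (Set.indicator Ωp (fun _ => (1:ℝ)) y - Set.indicator Ωm (fun _ => (1:ℝ)) y) * coul x y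

/-- A bounded open set has Lipschitz boundary if near each boundary point, after
choosing a unit direction `ν`, the set is the region above the graph of a
Lipschitz function over the hyperplane orthogonal to `ν`. -/
def HasLipschitzBoundary (Ω : Set E3) : Prop :=
  ∀ x ∈ frontier Ω, ∃ (ν : E3) (ψ : E3 → ℝ) (K : NNReal) (r : ℝ),
    ‖ν‖ = 1 ∧ LipschitzWith K ψ ∧ 0 < r ∧
    ∀ (v : E3) (t : ℝ), ⟪v, ν⟫ = 0 → x + v + t • ν ∈ Metric.ball x r →
      (x + v + t • ν ∈ Ω ↔ ψ v < t)


/-- The interior ball condition: every boundary point is touched from inside by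
an open ball contained in `Ω`. -/
def InteriorBallCondition (Ω : Set E3) : Prop :=
  ∀ x ∈ frontier Ω, ∃ (c : E3) (ρ : ℝ), 0 < ρ ∧ Metric.ball c ρ ⊆ Ω ∧ dist x c = ρ

open Metric Set

lemma coul_comm (x y : E3) : coul x y = coul y x := by
  simp only [coul, norm_sub_rev]

lemma coul_nonneg (x y : E3) : 0 ≤ coul x y := by
  unfold coul; positivity

lemma measurable_uncurry_coul : Measurable (Function.uncurry coul) := by
  unfold Function.uncurry coul
  fun_prop

lemma measurable_coul_left (y : E3) : Measurable fun x => coul x y := by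
  unfold coul; fun_prop

lemma preimage_sub_ball_zero (c : E3) (r : ℝ) : (fun x => x - c) ⁻¹' ball 0 r = ball c r := by
  ext x
  simp [dist_eq_norm]

lemma integrableOn_coul_ball_self (c : E3) (r : ℝ) :
    IntegrableOn (fun x => coul x c) (ball c r) := by
  have h0 : IntegrableOn (fun x : E3 => (fun s : ℝ => 1 / (4 * π * s)) ‖x‖) (ball 0 r) := by
    refine (integrableOn_fun_norm_addHaar volume (f := fun s : ℝ => 1 / (4 * π * s))).2 ?_
    have hc : IntegrableOn (fun y : ℝ => y / (4 * π)) (Ioo 0 r) :=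
      (Continuous.integrableOn_Icc (by fun_prop)).mono_set Ioo_subset_Icc_self
    refine hc.congr_fun (fun s hs => ?_) measurableSet_Ioo
    have : s ≠ 0 := hs.1.ne'
    simp
    field_simp
  have := (measurePreserving_sub_right (volume : Measure E3) c).integrableOn_comp_preimage
    (MeasurableEquiv.subRight c).measurableEmbedding (f := fun x : E3 => 1 / (4 * π * ‖x‖))
    (s := ball 0 r)
  rw [preimage_sub_ball_zero] at this
  simpa [Function.comp_def, coul] using this.2 h0

lemma integral_coul_ball_self (c : E3) {r : ℝ} (hr : 0 ≤ r) :
    ∫ x in ball c r, coul x c = r ^ 2 / 2 := by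
  have h0 : ∫ x in ball (0 : E3) r, 1 / (4 * π * ‖x‖) = r ^ 2 / 2 := by
    have h1 : ∫ x in ball (0 : E3) r, 1 / (4 * π * ‖x‖)
        = ∫ x : E3, (Iio r).indicator (fun s : ℝ => 1 / (4 * π * s)) ‖x‖ := by
      rw [← integral_indicator measurableSet_ball]
      congr 1 with x
      simp [indicator]
    rw [h1, integral_fun_norm_addHaar]
    have h2 : ∫ y in Ioi (0 : ℝ), y ^ (Module.finrank ℝ E3 - 1) •
        (Iio r).indicator (fun s : ℝ => 1 / (4 * π * s)) y = ∫ y in (0 : ℝ)..r, y / (4 * π) := by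
      rw [intervalIntegral.integral_of_le hr, integral_Ioc_eq_integral_Ioo,
        ← integral_indicator measurableSet_Ioi, ← integral_indicator measurableSet_Ioo]
      congr 1 with y
      by_cases h : 0 < y <;> by_cases h' : y < r <;> simp [h, h']
      field_simp
    rw [h2]
    simp [measureReal_def, ENNReal.toReal_ofReal (by positivity : (0 : ℝ) ≤ π * 4 / 3)]
    field_simp
  have := (measurePreserving_sub_right (volume : Measure E3) c).setIntegral_preimage_emb
    (MeasurableEquiv.subRight c).measurableEmbedding (fun x : E3 => 1 / (4 * π * ‖x‖))
    (ball 0 r)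
  rw [preimage_sub_ball_zero, h0] at this
  simpa [coul] using this

lemma coul_le_of_le_norm {x y : E3} {s : ℝ} (hs : 0 < s) (h : s ≤ ‖x - y‖) :
    coul x y ≤ 1 / (4 * π * s) := by
  unfold coul
  gcongr

/-- The potential of a bounded integrable density converges absolutely, with an explicit bound. -/
lemma integrable_mul_coul {f : E3 → ℝ} {C : ℝ} (hf : Integrable f) (hC : ∀ y, |f y| ≤ C)
    (x : E3) : Integrable fun y => f y * coul x y := by
  have hC0 : 0 ≤ C := (abs_nonneg _).trans (hC 0)
  have h1 : Integrable ((ball x 1).indicator fun y => coul y x) :=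
    (integrable_indicator_iff measurableSet_ball).2 (integrableOn_coul_ball_self x 1)
  have h2 : Integrable fun y => C * (ball x 1).indicator (fun y => coul y x) y
      + |f y| * (1 / (4 * π * 1)) := (h1.const_mul C).add (hf.abs.mul_const _)
  refine h2.mono' ?_ (.of_forall fun y => ?_)
  · simp_rw [coul_comm x]
    exact hf.aestronglyMeasurable.mul (measurable_coul_left x).aestronglyMeasurable
  · rw [norm_mul, Real.norm_eq_abs, Real.norm_of_nonneg (coul_nonneg _ _), coul_comm]
    by_cases hy : y ∈ ball x 1
    · rw [indicator_of_mem hy]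
      have := mul_le_mul_of_nonneg_right (hC y) (coul_nonneg y x)
      have : 0 ≤ |f y| * (1 / (4 * π * 1)) := by positivity
      linarith
    · rw [indicator_of_notMem hy]
      have := mul_le_mul_of_nonneg_left
        (coul_le_of_le_norm one_pos (by simpa [dist_eq_norm] using hy : 1 ≤ ‖y - x‖)) (abs_nonneg (f y))
      linarith
/-- Axial splitting of `ℝ³` as the first coordinate axis times its orthogonal plane. -/
def axialEquiv : ℝ × EuclideanSpace ℝ (Fin 2) ≃ᵐ E3 :=
  ((MeasurableEquiv.refl ℝ).prodCongr (MeasurableEquiv.toLp 2 (Fin 2 → ℝ)).symm).trans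
    ((MeasurableEquiv.piFinSuccAbove (fun _ : Fin 3 => ℝ) 0).symm.trans
      (MeasurableEquiv.toLp 2 (Fin 3 → ℝ)))

lemma measurePreserving_axialEquiv : MeasurePreserving axialEquiv := by
  refine MeasurePreserving.trans (μb := volume) ?_ (MeasurePreserving.trans (μb := volume) ?_ ?_)
  · exact (MeasurePreserving.id (volume : Measure ℝ)).prod (PiLp.volume_preserving_ofLp (Fin 2))
  · exact (volume_preserving_piFinSuccAbove (fun _ : Fin 3 => ℝ) 0).symm _
  · exact PiLp.volume_preserving_toLp (Fin 3)

lemma norm_axialEquiv_sub_single (z d : ℝ) (v : EuclideanSpace ℝ (Fin 2)) :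
    ‖axialEquiv (z, v) - EuclideanSpace.single 0 d‖ = √((z - d) ^ 2 + ‖v‖ ^ 2) := by
  rw [EuclideanSpace.norm_eq, EuclideanSpace.norm_sq_eq, Fin.sum_univ_three, Fin.sum_univ_two]
  have h0 : axialEquiv (z, v) 0 = z := rfl
  have h1 : axialEquiv (z, v) 1 = v 0 := rfl
  have h2 : axialEquiv (z, v) 2 = v 1 := rfl
  simp [h0, h1, h2, add_assoc]

lemma norm_axialEquiv (z : ℝ) (v : EuclideanSpace ℝ (Fin 2)) :
    ‖axialEquiv (z, v)‖ = √(z ^ 2 + ‖v‖ ^ 2) := by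
  have h := norm_axialEquiv_sub_single z 0 v
  rwa [show EuclideanSpace.single (0 : Fin 3) (0 : ℝ) = 0 by ext; simp, sub_zero, sub_zero] at h

lemma integrableOn_coul {A : Set E3} (hA : MeasurableSet A) (hA' : volume A ≠ ⊤) (x : E3) :
    IntegrableOn (fun y => coul y x) A := by
  rw [← integrable_indicator_iff hA]
  have hi : Integrable (A.indicator fun _ => (1 : ℝ)) :=
    (integrable_indicator_iff hA).2 (integrableOn_const hA')
  refine (integrable_mul_coul (C := 1) hi (fun y => ?_) x).congr (.of_forall fun y => ?_)
  · by_cases h : y ∈ A <;> simp [h]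
  · by_cases h : y ∈ A <;> simp [h, coul_comm]

/-- Potential of a disc on its axis. -/
lemma integral_disc_axis {a R : ℝ} (ha : a ≠ 0) (hR : 0 ≤ R) :
    ∫ v : EuclideanSpace ℝ (Fin 2), (Iio R).indicator (fun s => 1 / (4 * π * √(a ^ 2 + s ^ 2))) ‖v‖
      = (√(a ^ 2 + R ^ 2) - |a|) / 2 := by
  rw [integral_fun_norm_addHaar]
  have hpos : ∀ s : ℝ, 0 < a ^ 2 + s ^ 2 := fun s => by positivity
  have h2 : ∫ y in Ioi (0 : ℝ), y ^ (Module.finrank ℝ (EuclideanSpace ℝ (Fin 2)) - 1) •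
      (Iio R).indicator (fun s : ℝ => 1 / (4 * π * √(a ^ 2 + s ^ 2))) y
      = ∫ y in (0 : ℝ)..R, y / (4 * π * √(a ^ 2 + y ^ 2)) := by
    rw [intervalIntegral.integral_of_le hR, integral_Ioc_eq_integral_Ioo,
      ← integral_indicator measurableSet_Ioi, ← integral_indicator measurableSet_Ioo]
    congr 1 with y
    by_cases h : 0 < y <;> by_cases h' : y < R <;> simp [h, h']
    field_simp
  have hd : ∀ s ∈ uIcc 0 R, HasDerivAt (fun y => √(a ^ 2 + y ^ 2) / (4 * π))
      (s / (4 * π * √(a ^ 2 + s ^ 2))) s := fun s _ => by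
    have h := (((hasDerivAt_id s).pow 2).const_add (a ^ 2)).sqrt (hpos s).ne'
    have h := h.div_const (4 * π)
    refine HasDerivAt.congr_deriv h ?_
    have := (Real.sqrt_pos.2 (hpos s)).ne'
    simp only [id, Pi.pow_apply, Nat.reduceSub, Nat.cast_ofNat, pow_one]
    field_simp
  have hc : Continuous fun y => y / (4 * π * √(a ^ 2 + y ^ 2)) := by
    refine continuous_id.div (by fun_prop) fun y => ?_
    have := (Real.sqrt_pos.2 (hpos y)).ne'
    positivity
  rw [h2, intervalIntegral.integral_eq_sub_of_hasDerivAt hd (hc.intervalIntegrable _ _)]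
  simp [measureReal_def, Real.sqrt_sq_eq_abs, pi_pos.le]
  field_simp
  ring

lemma integral_coul_ball_single (d : ℝ) {r : ℝ} (hr : 0 ≤ r) :
    ∫ x in ball (0 : E3) r, coul x (EuclideanSpace.single 0 d)
      = ∫ z in (-r)..r, (√(d ^ 2 + r ^ 2 - 2 * d * z) - |z - d|) / 2 := by
  set w : E3 := EuclideanSpace.single 0 d
  have hcoul : Integrable ((ball (0 : E3) r).indicator fun x => coul x w) :=
    (integrable_indicator_iff measurableSet_ball).2
      (integrableOn_coul measurableSet_ball measure_ball_lt_top.ne w)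
  have hprod := integral_prod _ (measurePreserving_axialEquiv.integrable_comp_of_integrable hcoul)
  simp only [Function.comp_apply] at hprod
  rw [← integral_indicator measurableSet_ball,
    ← measurePreserving_axialEquiv.integral_comp axialEquiv.measurableEmbedding,
    Measure.volume_eq_prod, hprod,
    intervalIntegral.integral_of_le (by linarith), integral_Ioc_eq_integral_Ioo,
    ← integral_indicator measurableSet_Ioo]
  refine integral_congr_ae ?_
  filter_upwards [Measure.ae_ne volume d] with z hz
  have hzd : z - d ≠ 0 := sub_ne_zero.2 hz
  by_cases hzr : z ∈ Ioo (-r) r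
  · have hz2 : 0 ≤ r ^ 2 - z ^ 2 := by nlinarith [hzr.1, hzr.2]
    rw [indicator_of_mem hzr]
    have := integral_disc_axis hzd (Real.sqrt_nonneg (r ^ 2 - z ^ 2))
    rw [Real.sq_sqrt hz2] at this
    convert this using 4 with v
    · have : axialEquiv (z, v) ∈ ball (0 : E3) r ↔ ‖v‖ ∈ Iio √(r ^ 2 - z ^ 2) := by
        rw [mem_ball_zero_iff, norm_axialEquiv, mem_Iio, Real.sqrt_lt' (by linarith [hzr.1, hzr.2]),
          Real.lt_sqrt (norm_nonneg _)]
        constructor <;> intro <;> linarith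
      by_cases hv : axialEquiv (z, v) ∈ ball (0 : E3) r
      · rw [indicator_of_mem hv, indicator_of_mem (this.1 hv), coul, norm_axialEquiv_sub_single]
      · rw [indicator_of_notMem hv, indicator_of_notMem (mt this.2 hv)]
    · ring
  · rw [indicator_of_notMem hzr]
    refine (integral_congr_ae (.of_forall fun v => indicator_of_notMem ?_ _)).trans (integral_zero _ _)
    rw [mem_ball_zero_iff, norm_axialEquiv, not_lt]
    refine Real.le_sqrt_of_sq_le ?_
    by_contra! h
    exact hzr (abs_lt.1 (abs_lt_of_sq_lt_sq (by nlinarith [sq_nonneg ‖v‖]) hr))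

lemma integral_coul_ball_eq_single (c y : E3) (r : ℝ) :
    ∫ x in ball c r, coul x y
      = ∫ x in ball (0 : E3) r, coul x (EuclideanSpace.single 0 (dist y c)) := by
  set w : E3 := EuclideanSpace.single 0 (dist y c) with hw
  have h1 := (measurePreserving_sub_right (volume : Measure E3) c).setIntegral_preimage_emb
    (MeasurableEquiv.subRight c).measurableEmbedding (fun x : E3 => coul x (y - c)) (ball 0 r)
  rw [preimage_sub_ball_zero] at h1
  have hn : ‖y - c‖ = ‖w‖ := by simp [hw, dist_eq_norm]
  set R := Submodule.reflection (ℝ ∙ (y - c - w))ᗮ with hR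
  have hRw : R (y - c) = w := Submodule.reflection_sub hn
  have h2 := R.measurePreserving.setIntegral_preimage_emb
    R.toHomeomorph.measurableEmbedding (fun x : E3 => coul x w) (ball 0 r)
  have hp : R ⁻¹' ball 0 r = ball 0 r := by ext x; simp
  rw [hp] at h2
  rw [← h2, ← hRw]
  have h3 : ∀ x, coul (R x) (R (y - c)) = coul x (y - c) := fun x => by
    simp only [coul, ← map_sub, R.norm_map]
  simp_rw [h3]
  rw [← h1]
  simp [coul]

lemma integral_abs_sub (d r : ℝ) (hr : 0 ≤ r) (hd : 0 ≤ d) :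
    ∫ z in (-r)..r, |z - d| = if d ≤ r then d ^ 2 + r ^ 2 else 2 * d * r := by
  have key : ∀ a b : ℝ, a ≤ b → b ≤ d → ∫ z in a..b, |z - d| = (b - a) * d - (b ^ 2 - a ^ 2) / 2 := by
    intro a b hab hbd
    have : ∫ z in a..b, |z - d| = ∫ z in a..b, (d - z) := by
      refine intervalIntegral.integral_congr fun z hz => ?_
      rw [uIcc_of_le hab] at hz
      rw [abs_of_nonpos (by linarith [hz.2])]; ring
    rw [this, intervalIntegral.integral_sub (by simp) (by simp)]
    simp
  have key' : ∀ a b : ℝ, a ≤ b → d ≤ a → ∫ z in a..b, |z - d| = (b ^ 2 - a ^ 2) / 2 - (b - a) * d := by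
    intro a b hab hbd
    have : ∫ z in a..b, |z - d| = ∫ z in a..b, (z - d) := by
      refine intervalIntegral.integral_congr fun z hz => ?_
      rw [uIcc_of_le hab] at hz
      rw [abs_of_nonneg (by linarith [hz.1])]
    rw [this, intervalIntegral.integral_sub (by simp) (by simp)]
    simp
  have hi : ∀ a b : ℝ, IntervalIntegrable (fun z => |z - d|) volume a b := fun a b =>
    (by fun_prop : Continuous fun z => |z - d|).intervalIntegrable a b
  split_ifs with h
  · rw [← intervalIntegral.integral_add_adjacent_intervals (hi (-r) d) (hi d r),
      key _ _ (by linarith) le_rfl, key' _ _ h le_rfl]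
    ring
  · rw [key _ _ (by linarith) (by linarith)]
    ring

lemma integral_sqrt_affine {d r : ℝ} (hr : 0 ≤ r) (hd : 0 < d) :
    ∫ z in (-r)..r, √(d ^ 2 + r ^ 2 - 2 * d * z) = ((d + r) ^ 3 - |d - r| ^ 3) / (3 * d) := by
  have hnn : ∀ z ∈ Icc (-r) r, 0 ≤ d ^ 2 + r ^ 2 - 2 * d * z := fun z hz => by
    nlinarith [hz.2, sq_nonneg (d - r)]
  have hc : Continuous fun z : ℝ => -(√(d ^ 2 + r ^ 2 - 2 * d * z)) ^ 3 / (3 * d) := by fun_prop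
  rw [intervalIntegral.integral_eq_sub_of_hasDerivAt_of_le (by linarith) hc.continuousOn
    (f' := fun z => √(d ^ 2 + r ^ 2 - 2 * d * z))]
  · have h1 : d ^ 2 + r ^ 2 - 2 * d * r = (d - r) ^ 2 := by ring
    have h2 : d ^ 2 + r ^ 2 - 2 * d * -r = (d + r) ^ 2 := by ring
    simp only [h1, h2, Real.sqrt_sq_eq_abs]
    rw [abs_of_nonneg (by linarith : 0 ≤ d + r)]
    ring
  · intro z hz
    have hp : 0 < d ^ 2 + r ^ 2 - 2 * d * z := by
      nlinarith [hz.2, sq_nonneg (d - r), mul_pos hd (sub_pos.2 hz.2)]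
    have h := (((hasDerivAt_id z).const_mul (2 * d)).const_sub (d ^ 2 + r ^ 2)).sqrt hp.ne'
    have h := ((h.pow 3).neg).div_const (3 * d)
    refine HasDerivAt.congr_deriv h ?_
    have := (Real.sqrt_pos.2 hp).ne'
    simp only [id, Nat.reduceSub, Nat.cast_ofNat]
    generalize √(d ^ 2 + r ^ 2 - 2 * d * z) = q at this ⊢
    field_simp
  · exact (by fun_prop : Continuous fun z : ℝ => √(d ^ 2 + r ^ 2 - 2 * d * z)).intervalIntegrable _ _

lemma integral_coul_ball_aux (c y : E3) {r : ℝ} (hr : 0 ≤ r) (hy : y ≠ c) :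
    ∫ x in ball c r, coul x y = (((dist y c + r) ^ 3 - |dist y c - r| ^ 3) / (3 * dist y c)
      - (if dist y c ≤ r then dist y c ^ 2 + r ^ 2 else 2 * dist y c * r)) / 2 := by
  have hd : 0 < dist y c := dist_pos.2 hy
  rw [integral_coul_ball_eq_single, integral_coul_ball_single _ hr, intervalIntegral.integral_div,
    intervalIntegral.integral_sub, integral_abs_sub _ _ hr hd.le, integral_sqrt_affine hr hd]
  · exact (by fun_prop : Continuous fun z : ℝ =>
      √(dist y c ^ 2 + r ^ 2 - 2 * dist y c * z)).intervalIntegrable _ _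
  · exact (by fun_prop : Continuous fun z : ℝ => |z - dist y c|).intervalIntegrable _ _

/-- Newton's theorem for a ball: the potential inside. -/
lemma integral_coul_ball_of_dist_le {c y : E3} {r : ℝ} (hy : dist y c ≤ r) :
    ∫ x in ball c r, coul x y = r ^ 2 / 2 - dist y c ^ 2 / 6 := by
  have hr : 0 ≤ r := dist_nonneg.trans hy
  rcases eq_or_ne y c with rfl | hne
  · simp [integral_coul_ball_self y hr]
  · have hd : 0 < dist y c := dist_pos.2 hne
    rw [integral_coul_ball_aux c y hr hne, if_pos hy, abs_of_nonpos (by linarith)]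
    field_simp
    ring

/-- Newton's theorem for a ball: the potential outside. -/
lemma integral_coul_ball_of_le_dist {c y : E3} {r : ℝ} (hr : 0 < r) (hy : r ≤ dist y c) :
    ∫ x in ball c r, coul x y = r ^ 3 / (3 * dist y c) := by
  have hd : 0 < dist y c := hr.trans_le hy
  rcases hy.eq_or_lt with h | h
  · rw [integral_coul_ball_of_dist_le h.ge, ← h]
    field_simp
    ring
  · rw [integral_coul_ball_aux c y hr.le (dist_pos.1 hd), if_neg h.not_ge,
      abs_of_pos (by linarith)]
    field_simp
    ring

lemma integral_coul_ball_le {c y : E3} {r : ℝ} (hr : 0 < r) (hy : y ≠ c) :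
    ∫ x in ball c r, coul x y ≤ r ^ 3 / (3 * dist y c) := by
  have hd : 0 < dist y c := dist_pos.2 hy
  rcases le_total r (dist y c) with h | h
  · exact (integral_coul_ball_of_le_dist hr h).le
  · rw [integral_coul_ball_of_dist_le h, le_div_iff₀ (by positivity)]
    nlinarith [mul_nonneg (sq_nonneg (r - dist y c)) (by linarith : 0 ≤ 2 * r + dist y c)]

lemma volume_real_ball (c : E3) {r : ℝ} (hr : 0 ≤ r) :
    volume.real (ball c r) = 4 / 3 * π * r ^ 3 := by
  simp [measureReal_def, hr, ENNReal.toReal_ofReal (by positivity : (0 : ℝ) ≤ π * 4 / 3)]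
  ring

lemma volume_real_ball_mul_coul (c y : E3) {r : ℝ} (hr : 0 ≤ r) :
    volume.real (ball c r) * coul c y = r ^ 3 / (3 * dist y c) := by
  rw [volume_real_ball c hr, coul, dist_comm, dist_eq_norm]
  rcases eq_or_ne (‖c - y‖) 0 with h | h
  · simp [h]
  · field_simp

/-- The Coulomb kernel cut off at distance `s`. -/
def truncCoul (s : ℝ) (x y : E3) : ℝ := 1 / (4 * π * max ‖x - y‖ s)

/-- The Coulomb potential of a charge density `f`. -/
def pot (f : E3 → ℝ) (x : E3) : ℝ := ∫ y, f y * coul x y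

lemma truncCoul_nonneg {s : ℝ} (hs : 0 < s) (x y : E3) : 0 ≤ truncCoul s x y := by
  have : 0 < max ‖x - y‖ s := hs.trans_le (le_max_right _ _)
  unfold truncCoul; positivity

lemma truncCoul_le {s : ℝ} (hs : 0 < s) (x y : E3) : truncCoul s x y ≤ 1 / (4 * π * s) := by
  unfold truncCoul
  gcongr
  exact le_max_right _ _

lemma continuous_truncCoul {s : ℝ} (hs : 0 < s) (y : E3) : Continuous fun x => truncCoul s x y := by
  unfold truncCoul
  refine continuous_const.div (by fun_prop) fun x => ?_
  have : 0 < max ‖x - y‖ s := hs.trans_le (le_max_right _ _)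
  positivity

lemma measurable_truncCoul (s : ℝ) (x : E3) : Measurable fun y => truncCoul s x y := by
  unfold truncCoul
  fun_prop

lemma abs_mul_truncCoul_le {f : E3 → ℝ} {s : ℝ} (hs : 0 < s) (x y : E3) :
    |f y * truncCoul s x y| ≤ |f y| * (1 / (4 * π * s)) := by
  rw [abs_mul, abs_of_nonneg (truncCoul_nonneg hs x y)]
  exact mul_le_mul_of_nonneg_left (truncCoul_le hs x y) (abs_nonneg _)

lemma aestronglyMeasurable_mul_truncCoul {f : E3 → ℝ} (hf : Integrable f) (s : ℝ) (x : E3) :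
    AEStronglyMeasurable fun y => f y * truncCoul s x y :=
  hf.aestronglyMeasurable.mul (measurable_truncCoul s x).aestronglyMeasurable

lemma integrable_mul_truncCoul {f : E3 → ℝ} (hf : Integrable f) {s : ℝ} (hs : 0 < s) (x : E3) :
    Integrable fun y => f y * truncCoul s x y :=
  (hf.abs.mul_const (1 / (4 * π * s))).mono' (aestronglyMeasurable_mul_truncCoul hf s x)
    (.of_forall fun y => abs_mul_truncCoul_le hs x y)

lemma continuous_integral_truncCoul {f : E3 → ℝ} (hf : Integrable f) {s : ℝ} (hs : 0 < s) :
    Continuous fun x => ∫ y, f y * truncCoul s x y :=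
  continuous_of_dominated (aestronglyMeasurable_mul_truncCoul hf s)
    (fun x => .of_forall fun y => abs_mul_truncCoul_le hs x y) (hf.abs.mul_const _)
    (.of_forall fun y => continuous_const.mul (continuous_truncCoul hs y))

open Filter Topology in
lemma tendsto_integral_truncCoul {f : E3 → ℝ} (hf : Integrable f) {s : ℝ} (hs : 0 < s) :
    Tendsto (fun x => ∫ y, f y * truncCoul s x y) (cocompact E3) (𝓝 0) := by
  have h0 : ∀ y : E3, Tendsto (fun x => f y * truncCoul s x y) (cocompact E3) (𝓝 0) := fun y => by
    have h1 : Tendsto (fun x : E3 => dist x y) (cocompact E3) atTop :=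
      tendsto_dist_right_cocompact_atTop y
    have h2 : Tendsto (fun x : E3 => 4 * π * max ‖x - y‖ s) (cocompact E3) atTop := by
      refine Tendsto.const_mul_atTop (by positivity) (tendsto_atTop_mono (fun x => ?_) h1)
      rw [dist_eq_norm]
      exact le_max_left _ _
    simpa [truncCoul] using h2.inv_tendsto_atTop.const_mul (f y)
  have : (cocompact E3).IsCountablyGenerated := by
    rw [← Metric.cobounded_eq_cocompact, ← comap_norm_atTop]
    infer_instance
  simpa using tendsto_integral_filter_of_dominated_convergence _
    (.of_forall (aestronglyMeasurable_mul_truncCoul hf s))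
    (.of_forall fun x => .of_forall fun y => abs_mul_truncCoul_le hs x y)
    (hf.abs.mul_const _) (.of_forall h0)

lemma abs_pot_sub_truncCoul_le {f : E3 → ℝ} {C : ℝ} (hf : Integrable f) (hC : ∀ y, |f y| ≤ C)
    {s : ℝ} (hs : 0 < s) (x : E3) :
    |pot f x - ∫ y, f y * truncCoul s x y| ≤ C * (s ^ 2 / 2) := by
  have h1 : Integrable ((ball x s).indicator fun y => coul y x) :=
    (integrable_indicator_iff measurableSet_ball).2 (integrableOn_coul_ball_self x s)
  rw [pot, ← integral_sub (integrable_mul_coul hf hC x) (integrable_mul_truncCoul hf hs x),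
    ← integral_coul_ball_self x hs.le, ← integral_indicator measurableSet_ball,
    ← integral_const_mul]
  rw [← Real.norm_eq_abs]
  refine norm_integral_le_of_norm_le (h1.const_mul C) ?_
  filter_upwards [Measure.ae_ne volume x] with y hy
  rw [← mul_sub, norm_mul, Real.norm_eq_abs, Real.norm_eq_abs]
  refine mul_le_mul (hC y) ?_ (abs_nonneg _) ((abs_nonneg _).trans (hC y))
  have hxy : 0 < ‖x - y‖ := norm_pos_iff.2 (sub_ne_zero.2 hy.symm)
  by_cases hys : y ∈ ball x s
  · rw [indicator_of_mem hys, coul_comm y x]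
    have h2 : truncCoul s x y ≤ coul x y := by
      unfold truncCoul coul
      gcongr
      exact le_max_left _ _
    rw [abs_of_nonneg (by linarith)]
    linarith [truncCoul_nonneg hs x y]
  · rw [indicator_of_notMem hys]
    have : max ‖x - y‖ s = ‖x - y‖ := max_eq_left (by
      rw [← dist_eq_norm, dist_comm]; simpa using hys)
    simp [truncCoul, coul, this]

open Filter Topology in
lemma tendstoUniformly_truncCoul {f : E3 → ℝ} {C : ℝ} (hf : Integrable f) (hC : ∀ y, |f y| ≤ C) :
    TendstoUniformly (fun s x => ∫ y, f y * truncCoul s x y) (pot f) (𝓝[>] (0 : ℝ)) := by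
  rw [Metric.tendstoUniformly_iff]
  intro ε hε
  have h : Tendsto (fun s : ℝ => C * (s ^ 2 / 2)) (𝓝[>] 0) (𝓝 0) := by
    refine tendsto_nhdsWithin_of_tendsto_nhds ?_
    have : Continuous fun s : ℝ => C * (s ^ 2 / 2) := by fun_prop
    simpa using this.tendsto 0
  filter_upwards [h.eventually_lt_const hε, self_mem_nhdsWithin] with s hs hs0 x
  exact (abs_pot_sub_truncCoul_le hf hC hs0 x).trans_lt hs

open Filter Topology in
lemma continuous_pot {f : E3 → ℝ} {C : ℝ} (hf : Integrable f) (hC : ∀ y, |f y| ≤ C) :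
    Continuous (pot f) := by
  refine (tendstoUniformly_truncCoul hf hC).continuous (Eventually.frequently ?_)
  filter_upwards [self_mem_nhdsWithin] with s hs using continuous_integral_truncCoul hf hs

open Filter Topology in
lemma tendsto_pot_cocompact {f : E3 → ℝ} {C : ℝ} (hf : Integrable f) (hC : ∀ y, |f y| ≤ C) :
    Tendsto (pot f) (cocompact E3) (𝓝 0) := by
  refine (tendstoUniformly_truncCoul hf hC).tendsto_of_eventually_tendsto ?_ tendsto_const_nhds
  filter_upwards [self_mem_nhdsWithin] with s hs using tendsto_integral_truncCoul hf hs

lemma exists_abs_pot_le {f : E3 → ℝ} {C : ℝ} (hf : Integrable f) (hC : ∀ y, |f y| ≤ C) :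
    ∃ K, ∀ x, |pot f x| ≤ K := by
  refine ⟨C * (1 ^ 2 / 2) + ∫ y, |f y| * (1 / (4 * π * 1)), fun x => ?_⟩
  have h1 := abs_pot_sub_truncCoul_le hf hC one_pos x
  have h2 : |∫ y, f y * truncCoul 1 x y| ≤ ∫ y, |f y| * (1 / (4 * π * 1)) := by
    rw [← Real.norm_eq_abs]
    exact norm_integral_le_of_norm_le (hf.abs.mul_const _)
      (.of_forall fun y => abs_mul_truncCoul_le one_pos x y)
  have := abs_sub_abs_le_abs_sub (pot f x) (∫ y, f y * truncCoul 1 x y)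
  linarith

lemma integrableOn_pot {f : E3 → ℝ} {C : ℝ} (hf : Integrable f) (hC : ∀ y, |f y| ≤ C)
    {A : Set E3} (hA : volume A ≠ ⊤) : IntegrableOn (pot f) A := by
  obtain ⟨K, hK⟩ := exists_abs_pot_le hf hC
  have : IsFiniteMeasure (volume.restrict A) := ⟨by simpa using hA.lt_top⟩
  exact (integrable_const K).mono' (continuous_pot hf hC).aestronglyMeasurable
    (.of_forall hK)

lemma integrable_prod_mul_coul {f : E3 → ℝ} {C : ℝ} (hf : Integrable f) (hC : ∀ y, |f y| ≤ C)
    {A : Set E3} (hA : volume A ≠ ⊤) :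
    Integrable (Function.uncurry fun x y => f y * coul x y) ((volume.restrict A).prod volume) := by
  have hm : AEStronglyMeasurable (Function.uncurry fun x y => f y * coul x y)
      ((volume.restrict A).prod volume) :=
    (hf.aestronglyMeasurable.comp_snd).mul measurable_uncurry_coul.aestronglyMeasurable
  refine (integrable_prod_iff hm).2 ⟨.of_forall fun x => integrable_mul_coul hf hC x, ?_⟩
  refine (integrableOn_pot hf.abs (C := C) (by simpa using hC) hA).congr (.of_forall fun x => ?_)
  simp [pot, abs_of_nonneg (coul_nonneg _ _)]

lemma setIntegral_pot {f : E3 → ℝ} {C : ℝ} (hf : Integrable f) (hC : ∀ y, |f y| ≤ C)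
    {A : Set E3} (hA : volume A ≠ ⊤) :
    ∫ x in A, pot f x = ∫ y, f y * ∫ x in A, coul x y := by
  simp_rw [pot]
  rw [integral_integral_swap (integrable_prod_mul_coul hf hC hA)]
  simp_rw [integral_const_mul]

/-- Super-mean value property of the potential of a density which is nonnegative on a ball. -/
lemma setIntegral_ball_pot_le {f : E3 → ℝ} {C : ℝ} (hf : Integrable f) (hC : ∀ y, |f y| ≤ C)
    {c : E3} {r : ℝ} (hr : 0 < r) (hpos : ∀ᵐ y, y ∈ ball c r → 0 ≤ f y) :
    ∫ x in ball c r, pot f x ≤ volume.real (ball c r) * pot f c := by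
  have hA : volume (ball c r) ≠ ⊤ := measure_ball_lt_top.ne
  rw [setIntegral_pot hf hC hA, pot, ← integral_const_mul]
  have hi : Integrable fun y => f y * ∫ x in ball c r, coul x y := by
    simpa [Function.uncurry, integral_const_mul] using
      (integrable_prod_mul_coul hf hC hA).integral_prod_right
  refine integral_mono_ae hi ((integrable_mul_coul hf hC c).const_mul _) ?_
  filter_upwards [hpos, Measure.ae_ne volume c] with y hy hyc
  rw [mul_left_comm, volume_real_ball_mul_coul c y hr.le]
  by_cases h : y ∈ ball c r
  · exact mul_le_mul_of_nonneg_left (integral_coul_ball_le hr hyc) (hy h)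
  · rw [integral_coul_ball_of_le_dist hr (by simpa using h)]

lemma integrable_indicator_one {A : Set E3} (hA : MeasurableSet A) (hA' : volume A ≠ ⊤) :
    Integrable (A.indicator fun _ => (1 : ℝ)) :=
  (integrable_indicator_iff hA).2 (integrableOn_const hA')

lemma abs_indicator_one_le (A : Set E3) (y : E3) : |A.indicator (fun _ => (1 : ℝ)) y| ≤ 1 := by
  by_cases h : y ∈ A <;> simp [h]

lemma pot_indicator {A : Set E3} (hA : MeasurableSet A) (x : E3) :
    pot (A.indicator fun _ => 1) x = ∫ y in A, coul x y := by
  rw [pot, ← integral_indicator hA]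
  congr 1 with y
  by_cases h : y ∈ A <;> simp [h]

lemma pot_indicator_ball (c x : E3) (r : ℝ) :
    pot ((ball c r).indicator fun _ => 1) x = ∫ y in ball c r, coul y x := by
  simp_rw [pot_indicator measurableSet_ball, coul_comm x]

lemma pot_add {f g : E3 → ℝ} {C D : ℝ} (hf : Integrable f) (hC : ∀ y, |f y| ≤ C)
    (hg : Integrable g) (hD : ∀ y, |g y| ≤ D) (x : E3) :
    pot (fun y => f y + g y) x = pot f x + pot g x := by
  simp_rw [pot, add_mul]
  exact integral_add (integrable_mul_coul hf hC x) (integrable_mul_coul hg hD x)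

lemma pot_sub {f g : E3 → ℝ} {C D : ℝ} (hf : Integrable f) (hC : ∀ y, |f y| ≤ C)
    (hg : Integrable g) (hD : ∀ y, |g y| ≤ D) (x : E3) :
    pot (fun y => f y - g y) x = pot f x - pot g x := by
  simp_rw [pot, sub_mul]
  exact integral_sub (integrable_mul_coul hf hC x) (integrable_mul_coul hg hD x)

/-- Ball averages of the potential of a density bounded by one exceed the value at the centre by
at most a quadratic term. -/
lemma setIntegral_ball_pot_le_add {f : E3 → ℝ} (hf : Integrable f) (hC : ∀ y, |f y| ≤ 1)
    (c : E3) {r : ℝ} (hr : 0 < r) :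
    ∫ x in ball c r, pot f x ≤ volume.real (ball c r) * (pot f c + r ^ 2 / 2) := by
  have hg := integrable_indicator_one (measurableSet_ball (x := c) (ε := r)) measure_ball_lt_top.ne
  have hD := abs_indicator_one_le (ball c r)
  have h := setIntegral_ball_pot_le (c := c) (hf.add hg) (C := 2)
    (fun y => (abs_add_le _ _).trans (by linarith [hC y, hD y])) hr
    (.of_forall fun y hy => by
      simp only [Pi.add_apply, indicator_of_mem hy]
      linarith [neg_le_of_abs_le (hC y)])
  have hadd := pot_add hf hC hg hD
  change ∫ x in ball c r, pot (fun y => f y + (ball c r).indicator (fun _ => 1) y) x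
    ≤ _ * pot (fun y => f y + (ball c r).indicator (fun _ => 1) y) c at h
  simp_rw [hadd] at h
  rw [pot_indicator_ball c c r, integral_coul_ball_self c hr.le] at h
  refine le_trans ?_ h
  refine integral_mono (integrableOn_pot hf hC measure_ball_lt_top.ne)
    ((integrableOn_pot hf hC measure_ball_lt_top.ne).add
      (integrableOn_pot hg hD measure_ball_lt_top.ne)) fun x => ?_
  have : 0 ≤ pot ((ball c r).indicator fun _ => 1) x := by
    rw [pot_indicator_ball]
    exact integral_nonneg fun y => coul_nonneg y x
  simpa using this

/-- Minimum principle: a continuous function with the super-mean value property at a minimum point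
in an open set also attains this minimum on the boundary. -/
lemma exists_frontier_eq_of_setIntegral_ball_le {g : E3 → ℝ} (hg : Continuous g) {U : Set E3}
    (hU : IsOpen U) (hne : Uᶜ.Nonempty) {x₀ : E3} (hx₀ : x₀ ∈ U) (hmin : ∀ y ∈ U, g x₀ ≤ g y)
    (hsup : ∀ r > 0, ball x₀ r ⊆ U →
      ∫ x in ball x₀ r, g x ≤ volume.real (ball x₀ r) * g x₀) :
    ∃ z, z ∉ U ∧ z ∈ closure U ∧ g z = g x₀ := by
  obtain ⟨z, hzU, hz⟩ := hU.isClosed_compl.exists_infDist_eq_dist hne x₀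
  have hs : 0 < dist x₀ z := dist_pos.2 fun h => hzU (h ▸ hx₀)
  set s := dist x₀ z with hsdef
  have hsub : ball x₀ s ⊆ U := by
    have := disjoint_ball_infDist (s := Uᶜ) (x := x₀)
    rw [hz] at this
    exact disjoint_compl_right_iff_subset.1 this
  have hcl : z ∈ closure (ball x₀ s) := by
    rw [closure_ball _ hs.ne', mem_closedBall, dist_comm]
  have hgi : IntegrableOn g (ball x₀ s) :=
    (hg.continuousOn.integrableOn_compact (isCompact_closedBall x₀ s)).mono_set ball_subset_closedBall
  have hci : IntegrableOn (fun _ => g x₀) (ball x₀ s) :=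
    integrableOn_const measure_ball_lt_top.ne
  have h0 : ∫ x in ball x₀ s, (g x - g x₀) = 0 := by
    refine le_antisymm ?_ (setIntegral_nonneg measurableSet_ball fun x hx =>
      sub_nonneg.2 (hmin x (hsub hx)))
    rw [integral_sub hgi hci, setIntegral_const, smul_eq_mul]
    linarith [hsup s hs hsub]
  have hae : g =ᵐ[volume.restrict (ball x₀ s)] fun _ => g x₀ := by
    have h1 : 0 ≤ᵐ[volume.restrict (ball x₀ s)] fun x => g x - g x₀ :=
      (ae_restrict_iff' measurableSet_ball).2 (.of_forall fun x hx =>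
        sub_nonneg.2 (hmin x (hsub hx)))
    filter_upwards [(integral_eq_zero_iff_of_nonneg_ae h1 (hgi.sub hci)).1 h0] with x hx
    exact sub_eq_zero.1 hx
  have heq : EqOn g (fun _ => g x₀) (ball x₀ s) :=
    Measure.eqOn_open_of_ae_eq hae isOpen_ball hg.continuousOn continuousOn_const
  exact ⟨z, hzU, closure_mono hsub hcl, heq.closure hg continuous_const hcl⟩

/-- A potential is nonnegative if its density is nonnegative wherever the potential is negative. -/
lemma pot_nonneg {f : E3 → ℝ} {C : ℝ} (hf : Integrable f) (hC : ∀ y, |f y| ≤ C)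
    (hneg : ∀ᵐ y, pot f y < 0 → 0 ≤ f y) (x : E3) : 0 ≤ pot f x := by
  by_contra! hx
  have hc := continuous_pot hf hC
  obtain ⟨x₁, hx₁⟩ := hc.exists_forall_le' x
    (((tendsto_pot_cocompact hf hC).eventually_const_lt hx).mono fun y hy => hy.le)
  have hx₁neg : pot f x₁ < 0 := (hx₁ x).trans_lt hx
  by_cases hne : {y | pot f y < 0}ᶜ.Nonempty
  · obtain ⟨z, hz, -, hzeq⟩ := exists_frontier_eq_of_setIntegral_ball_le hc
      (isOpen_lt hc continuous_const) hne hx₁neg (fun y _ => hx₁ y)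
      fun r hr hsub => setIntegral_ball_pot_le hf hC hr (by
        filter_upwards [hneg] with y hy hyr using hy (hsub hyr))
    exact hz (hzeq.trans_lt hx₁neg)
  · rw [not_nonempty_iff_eq_empty, compl_empty_iff] at hne
    refine hx.not_ge (integral_nonneg_of_ae ?_)
    filter_upwards [hneg] with y hy
    exact mul_nonneg (hy (hne.ge (mem_univ y))) (coul_nonneg x y)

/-- Comparison with the torsion function on a ball of unit charge density. -/
lemma le_pot_of_mem_closedBall {f : E3 → ℝ} {C : ℝ} (hf : Integrable f) (hC : ∀ y, |f y| ≤ C)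
    (hpot : ∀ x, 0 ≤ pot f x) {c : E3} {ρ : ℝ} (hρ : 0 < ρ)
    (hone : ∀ᵐ y, y ∈ ball c ρ → f y = 1) {x : E3} (hx : x ∈ closedBall c ρ) :
    (ρ ^ 2 - dist x c ^ 2) / 6 ≤ pot f x := by
  have hg := integrable_indicator_one (measurableSet_ball (x := c) (ε := ρ)) measure_ball_lt_top.ne
  have hD := abs_indicator_one_le (ball c ρ)
  have hfg : Integrable fun y => f y - (ball c ρ).indicator (fun _ => 1) y := hf.sub hg
  have hE : ∀ y, |f y - (ball c ρ).indicator (fun _ => 1) y| ≤ C + 1 := fun y =>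
    (abs_sub _ _).trans (add_le_add (hC y) (hD y))
  have hsub : ∀ z ∈ closedBall c ρ, pot (fun y => f y - (ball c ρ).indicator (fun _ => 1) y) z
      = pot f z - (ρ ^ 2 / 2 - dist z c ^ 2 / 6) := fun z hz => by
    rw [pot_sub hf hC hg hD, pot_indicator_ball, integral_coul_ball_of_dist_le hz]
  set h := pot fun y => f y - (ball c ρ).indicator (fun _ => 1) y with hh
  have hcont : Continuous h := continuous_pot hfg hE
  suffices H : ∀ z ∈ closedBall c ρ, -(ρ ^ 2 / 3) ≤ h z by
    have := H x hx
    rw [hsub x hx] at this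
    linarith
  have hbdry : ∀ z, dist z c = ρ → -(ρ ^ 2 / 3) ≤ h z := fun z hz => by
    rw [hsub z hz.le, hz]
    linarith [hpot z]
  obtain ⟨x₁, hx₁, hmin⟩ := (isCompact_closedBall c ρ).exists_isMinOn
    (nonempty_closedBall.2 hρ.le) hcont.continuousOn
  suffices H : -(ρ ^ 2 / 3) ≤ h x₁ from fun z hz => H.trans (hmin hz)
  rcases (mem_closedBall.1 hx₁).eq_or_lt with h1 | h1
  · exact hbdry x₁ h1
  · obtain ⟨z, hz, hzcl, hzeq⟩ := exists_frontier_eq_of_setIntegral_ball_le hcont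
      (isOpen_ball (x := c) (ε := ρ)) ⟨x₁ + EuclideanSpace.single 0 (2 * ρ), by
        rw [mem_compl_iff, mem_ball, not_lt]
        have h2 := dist_triangle_right (x₁ + EuclideanSpace.single 0 (2 * ρ)) x₁ c
        have h3 : dist (x₁ + EuclideanSpace.single 0 (2 * ρ)) x₁ = 2 * ρ := by
          simp [abs_of_pos hρ]
        linarith⟩ h1
      (fun y hy => hmin (ball_subset_closedBall hy))
      fun r hr hr' => setIntegral_ball_pot_le hfg hE hr (by
        filter_upwards [hone] with y hy hyr
        simp [hy (hr' hyr), indicator_of_mem (hr' hyr)])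
    rw [← hzeq]
    rw [closure_ball c hρ.ne'] at hzcl
    exact hbdry z (le_antisymm hzcl (not_lt.1 hz))

/-- Hopf-type lemma: a nonnegative potential is positive at every point touched by a ball of unit
charge density. -/
lemma pot_pos_of_dist_eq {f : E3 → ℝ} (hf : Integrable f) (hC : ∀ y, |f y| ≤ 1)
    (hpot : ∀ x, 0 ≤ pot f x) {c : E3} {ρ : ℝ} (hρ : 0 < ρ)
    (hone : ∀ᵐ y, y ∈ ball c ρ → f y = 1) {x : E3} (hx : dist x c = ρ) : 0 < pot f x := by
  by_contra! hle
  set t := ρ / 1000 with ht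
  have ht0 : 0 < t := by positivity
  set p : E3 := x + (t / (2 * ρ)) • (c - x) with hp
  have hpx : dist p x = t / 2 := by
    rw [hp, dist_eq_norm, add_sub_cancel_left, norm_smul, ← dist_eq_norm, dist_comm, hx,
      Real.norm_of_nonneg (by positivity)]
    field_simp
  have hpc : dist p c = ρ - t / 2 := by
    have : p - c = (1 - t / (2 * ρ)) • (x - c) := by
      rw [hp]; module
    have h1 : 0 ≤ 1 - t / (2 * ρ) := by
      rw [ht, sub_nonneg, div_le_one (by positivity)]; linarith
    rw [dist_eq_norm, this, norm_smul, ← dist_eq_norm x c, hx, Real.norm_of_nonneg h1]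
    field_simp
  have hsub : ball p (t / 4) ⊆ ball x t := ball_subset_ball' (by rw [hpx]; linarith)
  have hlow : ∀ y ∈ ball p (t / 4), ρ * t / 24 ≤ pot f y := fun y hy => by
    have hyc : dist y c ≤ ρ - t / 4 := by
      linarith [dist_triangle y p c, mem_ball.1 hy]
    refine le_trans ?_ (le_pot_of_mem_closedBall hf hC hpot hρ hone
      (mem_closedBall.2 (by linarith)))
    nlinarith [dist_nonneg (x := y) (y := c)]
  have hup := setIntegral_ball_pot_le_add hf hC x ht0
  have h1 : ∫ y in ball p (t / 4), pot f y ≤ ∫ y in ball x t, pot f y :=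
    setIntegral_mono_set (integrableOn_pot hf hC measure_ball_lt_top.ne)
      (.of_forall hpot) hsub.eventuallyLE
  have h2 : volume.real (ball p (t / 4)) * (ρ * t / 24) ≤ ∫ y in ball p (t / 4), pot f y := by
    rw [← smul_eq_mul, ← setIntegral_const]
    exact setIntegral_mono_on (integrableOn_const measure_ball_lt_top.ne)
      (integrableOn_pot hf hC measure_ball_lt_top.ne) measurableSet_ball hlow
  rw [volume_real_ball _ ht0.le] at hup
  rw [volume_real_ball _ (by positivity)] at h2
  have h3 : 4 / 3 * π * t ^ 3 * (pot f x + t ^ 2 / 2) ≤ 4 / 3 * π * t ^ 3 * (t ^ 2 / 2) :=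
    mul_le_mul_of_nonneg_left (by linarith) (by positivity)
  have h4 : 4 / 3 * π * (t / 4) ^ 3 * (ρ * t / 24) ≤ 4 / 3 * π * t ^ 3 * (t ^ 2 / 2) := by linarith
  have h5 : ρ = 1000 * t := by rw [ht]; ring
  rw [h5] at h4
  have h6 : 0 < π * t ^ 5 := by positivity
  nlinarith

/-- The mutual Coulomb energy of two uniformly charged sets. -/
def mutualEnergy (A B : Set E3) : ℝ := ∫ x in A, ∫ y in B, coul x y

lemma mutualEnergy_comm {A B : Set E3} (hB : MeasurableSet B)
    (hA' : volume A ≠ ⊤) (hB' : volume B ≠ ⊤) : mutualEnergy A B = mutualEnergy B A := by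
  have h := setIntegral_pot (integrable_indicator_one hB hB') (abs_indicator_one_le B) hA'
  simp_rw [pot_indicator hB] at h
  rw [mutualEnergy, h, mutualEnergy, ← integral_indicator hB]
  congr 1 with y
  by_cases hy : y ∈ B <;> simp [hy, coul_comm y]

lemma integrableOn_setIntegral_coul {A B : Set E3} (hB : MeasurableSet B) (hB' : volume B ≠ ⊤)
    (hA' : volume A ≠ ⊤) : IntegrableOn (fun x => ∫ y in B, coul x y) A := by
  have h := integrableOn_pot (integrable_indicator_one hB hB') (abs_indicator_one_le B) hA'
  exact h.congr (.of_forall fun x => pot_indicator hB x)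

lemma mutualEnergy_diff_add {A B S : Set E3} (hA' : volume A ≠ ⊤)
    (hB : MeasurableSet B) (hB' : volume B ≠ ⊤) (hS : MeasurableSet S) (hSA : S ⊆ A) :
    mutualEnergy (A \ S) B + mutualEnergy S B = mutualEnergy A B := by
  have h := setIntegral_sdiff hS (integrableOn_setIntegral_coul hB hB' hA') hSA
  rw [mutualEnergy, h, mutualEnergy, mutualEnergy]
  ring

lemma potential_eq_pot (Ωp Ωm : Set E3) :
    potential Ωp Ωm = pot fun y => Ωp.indicator (fun _ => 1) y - Ωm.indicator (fun _ => 1) y := rfl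

section Minimizer

variable {Ωp Ωm : Set E3}

lemma potential_eq_sub (hp : MeasurableSet Ωp) (hp' : volume Ωp ≠ ⊤) (hm : MeasurableSet Ωm)
    (hm' : volume Ωm ≠ ⊤) (x : E3) :
    potential Ωp Ωm x = (∫ y in Ωp, coul x y) - ∫ y in Ωm, coul x y := by
  rw [potential_eq_pot, pot_sub (integrable_indicator_one hp hp') (abs_indicator_one_le Ωp)
    (integrable_indicator_one hm hm') (abs_indicator_one_le Ωm), pot_indicator hp,
    pot_indicator hm]

/-- First variation inequality of a minimizer under removal of negative charge. -/
lemma variation_nonneg (hp : MeasurableSet Ωp) (hp' : volume Ωp ≠ ⊤) (hadm : Adm Ωp Ωm)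
    (hmin : ∀ A, Adm Ωp A → energy Ωp Ωm ≤ energy Ωp A) {S : Set E3} (hS : MeasurableSet S)
    (hSm : S ⊆ Ωm) : 0 ≤ 2 * (∫ x in S, potential Ωp Ωm x) + mutualEnergy S S := by
  obtain ⟨hm, hnull, hmt⟩ := hadm
  have hm' := hmt.ne
  have hS' : volume S ≠ ⊤ := (measure_mono hSm).trans_lt hmt |>.ne
  have hT : MeasurableSet (Ωm \ S) := hm.diff hS
  have hTt : volume (Ωm \ S) < ⊤ := (measure_mono sdiff_subset).trans_lt hmt
  have hE : energy Ωp Ωm ≤ energy Ωp (Ωm \ S) :=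
    hmin _ ⟨hT, measure_mono_null (inter_subset_inter_right _ sdiff_subset) hnull, hTt⟩
  have hpot : ∫ x in S, potential Ωp Ωm x = mutualEnergy S Ωp - mutualEnergy S Ωm := by
    simp_rw [potential_eq_sub hp hp' hm hm']
    exact integral_sub (integrableOn_setIntegral_coul hp hp' hS')
      (integrableOn_setIntegral_coul hm hm' hS')
  change mutualEnergy Ωp Ωp + mutualEnergy Ωm Ωm - 2 * mutualEnergy Ωp Ωm
    ≤ mutualEnergy Ωp Ωp + mutualEnergy (Ωm \ S) (Ωm \ S) - 2 * mutualEnergy Ωp (Ωm \ S) at hE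
  have e1 := mutualEnergy_diff_add hm' hm hm' hS hSm
  have e2 := mutualEnergy_diff_add hm' hT hTt.ne hS hSm
  have e3 := mutualEnergy_diff_add hm' hS hS' hS hSm
  have e4 := mutualEnergy_diff_add hm' hp hp' hS hSm
  have c1 := mutualEnergy_comm hT hp' hTt.ne
  have c2 := mutualEnergy_comm hm hp' hm'
  have c3 := mutualEnergy_comm hT hm' hTt.ne
  have c4 := mutualEnergy_comm hm hS' hm'
  have c5 := mutualEnergy_comm hT hS' hTt.ne
  linarith

lemma integrable_charge (hp : MeasurableSet Ωp) (hp' : volume Ωp ≠ ⊤) (hm : MeasurableSet Ωm)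
    (hm' : volume Ωm ≠ ⊤) :
    Integrable fun y => Ωp.indicator (fun _ => (1 : ℝ)) y - Ωm.indicator (fun _ => 1) y :=
  (integrable_indicator_one hp hp').sub (integrable_indicator_one hm hm')

lemma abs_charge_le (Ωp Ωm : Set E3) (y : E3) :
    |Ωp.indicator (fun _ => (1 : ℝ)) y - Ωm.indicator (fun _ => 1) y| ≤ 1 := by
  by_cases h : y ∈ Ωp <;> by_cases h' : y ∈ Ωm <;> simp [h, h']

lemma continuous_potential (hp : MeasurableSet Ωp) (hp' : volume Ωp ≠ ⊤) (hm : MeasurableSet Ωm)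
    (hm' : volume Ωm ≠ ⊤) : Continuous (potential Ωp Ωm) :=
  continuous_pot (integrable_charge hp hp' hm hm') (abs_charge_le Ωp Ωm)

/-- A minimizer carries no negative charge where its potential is negative. -/
lemma volume_inter_potential_neg (hp : MeasurableSet Ωp) (hp' : volume Ωp ≠ ⊤)
    (hadm : Adm Ωp Ωm) (hmin : ∀ A, Adm Ωp A → energy Ωp Ωm ≤ energy Ωp A) :
    volume (Ωm ∩ {x | potential Ωp Ωm x < 0}) = 0 := by
  have hm := hadm.1
  have hm' := hadm.2.2.ne
  have hcont := continuous_potential hp hp' hm hm'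
  refine measure_null_of_locally_null _ fun x ⟨_, hx⟩ => ?_
  rw [mem_ofPred_eq] at hx
  obtain ⟨η₀, hη₀, hball⟩ := Metric.isOpen_iff.1 (isOpen_lt hcont continuous_const) x
    (show potential Ωp Ωm x < potential Ωp Ωm x / 2 by linarith)
  set ε := -(potential Ωp Ωm x / 2) with hε
  have hε0 : 0 < ε := by linarith
  set η := min η₀ (min 1 ε) with hη
  have hη0 : 0 < η := lt_min hη₀ (lt_min one_pos hε0)
  have hη1 : η ≤ 1 := (min_le_right _ _).trans (min_le_left _ _)
  have hηε : η ≤ ε := (min_le_right _ _).trans (min_le_right _ _)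
  set S := Ωm ∩ ball x η with hSdef
  have hS : MeasurableSet S := hm.inter measurableSet_ball
  have hS' : volume S ≠ ⊤ := ((measure_mono inter_subset_left).trans_lt hadm.2.2).ne
  refine ⟨S, ?_, ?_⟩
  · exact Filter.inter_mem (Filter.mem_of_superset self_mem_nhdsWithin inter_subset_left)
      (mem_nhdsWithin_of_mem_nhds (ball_mem_nhds x hη0))
  have hvar := variation_nonneg hp hp' hadm hmin hS inter_subset_left
  have h1 : ∫ y in S, potential Ωp Ωm y ≤ volume.real S * -ε := by
    rw [← smul_eq_mul, ← setIntegral_const]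
    refine setIntegral_mono_on (integrableOn_pot (integrable_charge hp hp' hm hm')
      (abs_charge_le Ωp Ωm) hS') (integrableOn_const hS') hS fun y hy => ?_
    have : potential Ωp Ωm y < potential Ωp Ωm x / 2 :=
      hball (ball_subset_ball (min_le_left _ _) hy.2)
    linarith
  have h2 : mutualEnergy S S ≤ volume.real S * (η ^ 2 / 2) := by
    rw [← smul_eq_mul, ← setIntegral_const, mutualEnergy]
    refine setIntegral_mono_on (integrableOn_setIntegral_coul hS hS' hS')
      (integrableOn_const hS') hS fun y hy => ?_
    simp_rw [coul_comm y]
    calc ∫ z in S, coul z y ≤ ∫ z in ball x η, coul z y :=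
          setIntegral_mono_set (integrableOn_coul measurableSet_ball measure_ball_lt_top.ne y)
            (.of_forall fun z => coul_nonneg z y) inter_subset_right.eventuallyLE
      _ = η ^ 2 / 2 - dist y x ^ 2 / 6 := integral_coul_ball_of_dist_le (mem_ball.1 hy.2).le
      _ ≤ η ^ 2 / 2 := by linarith [sq_nonneg (dist y x)]
  have h3 : volume.real S = 0 := by
    refine le_antisymm ?_ measureReal_nonneg
    by_contra! h
    nlinarith [mul_pos h hε0, mul_nonneg h.le (by nlinarith : 0 ≤ ε - η ^ 2)]
  exact (measureReal_eq_zero_iff hS').1 h3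

lemma potential_nonneg (hp : MeasurableSet Ωp) (hp' : volume Ωp ≠ ⊤)
    (hadm : Adm Ωp Ωm) (hmin : ∀ A, Adm Ωp A → energy Ωp Ωm ≤ energy Ωp A) (x : E3) :
    0 ≤ potential Ωp Ωm x := by
  refine pot_nonneg (integrable_charge hp hp' hadm.1 hadm.2.2.ne) (abs_charge_le Ωp Ωm) ?_ x
  filter_upwards [measure_eq_zero_iff_ae_notMem.1 (volume_inter_potential_neg hp hp' hadm hmin)]
    with y hy hneg
  have hym : y ∉ Ωm := fun h => hy ⟨h, hneg⟩
  rw [indicator_of_notMem hym, sub_zero]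
  exact indicator_nonneg (fun _ _ => zero_le_one) y

end Minimizer

/-- **Theorem 2.4(4)**: if `Ω⁺` satisfies an interior ball condition, then the
uncharged region `Ω₀ = ℝ³ \ closure {φ > 0}` has positive distance from
`∂Ω⁺`. -/
theorem uncharged_region_positive_distance
    (Ωp : Set E3) (ho : IsOpen Ωp) (hb : Bornology.IsBounded Ωp)
    (hlip : HasLipschitzBoundary Ωp) (hball : InteriorBallCondition Ωp)
    (Ωm : Set E3) (hadm : Adm Ωp Ωm)
    (hmin : ∀ A, Adm Ωp A → energy Ωp Ωm ≤ energy Ωp A) :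
    ∃ δ : ℝ, 0 < δ ∧
      ∀ x ∈ (closure {y | 0 < potential Ωp Ωm y})ᶜ, ∀ y ∈ frontier Ωp,
        δ ≤ dist x y := by
  have hp : MeasurableSet Ωp := ho.measurableSet
  have hp' : volume Ωp ≠ ⊤ := hb.measure_lt_top.ne
  have hm' : volume Ωm ≠ ⊤ := hadm.2.2.ne
  have hpos : frontier Ωp ⊆ {y | 0 < potential Ωp Ωm y} := fun x hx => by
    obtain ⟨c, ρ, hρ, hsub, hdist⟩ := hball x hx
    refine pot_pos_of_dist_eq (integrable_charge hp hp' hadm.1 hm') (abs_charge_le Ωp Ωm)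
      (potential_nonneg hp hp' hadm hmin) hρ ?_ hdist
    filter_upwards [measure_eq_zero_iff_ae_notMem.1 hadm.2.1] with y hy hyc
    have hym : y ∉ Ωm := fun h => hy ⟨hsub hyc, h⟩
    simp [hsub hyc, hym]
  have hcomp : IsCompact (frontier Ωp) :=
    isCompact_of_isClosed_isBounded isClosed_frontier
      (hb.closure.subset frontier_subset_closure)
  obtain ⟨δ, hδ, hthick⟩ := hcomp.exists_thickening_subset_open
    (isOpen_lt continuous_const (continuous_potential hp hp' hadm.1 hm')) hpos
  refine ⟨δ, hδ, fun x hx y hy => ?_⟩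
  by_contra! h
  exact hx (subset_closure (hthick (mem_thickening_iff.2 ⟨y, hy, h⟩)))
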